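/- arXiv:2605.19310 — 4 statements merged into one kernel-verified Lean document; each statement's English description precedes it below -/
import Mathlib

section
/- For every α > 0 there exists N₀ such that for every integer N ≥ N₀, every set A ⊆ {0,1,…,N−1} with |A| ≥ α·N contains a three-term arithmetic progression: there exist integers x and r with r ≠ 0 such that x, x+r, and x+2r all lie in A. -/
/-- **Roth's theorem.** For every `α > 0` there exists `N₀` such that for every
`N ≥ N₀`, every set `A ⊆ {0,1,…,N−1}` with `|A| ≥ α·N` contains a nontrivial
three-term arithmetic progression. -/
theorem roth_theorem (α : ℝ) (hα : 0 < α) :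
    ∃ N₀ : ℕ, ∀ N : ℕ, N₀ ≤ N →
      ∀ A : Finset ℤ, A ⊆ Finset.Ico (0 : ℤ) (N : ℤ) →
        α * N ≤ (A.card : ℝ) →
        ∃ x r : ℤ, r ≠ 0 ∧ x ∈ A ∧ x + r ∈ A ∧ x + 2 * r ∈ A := by
  refine ⟨cornersTheoremBound (α / 3), fun N hN A hA hcard ↦ ?_⟩
  have hmem : ∀ a ∈ A, 0 ≤ a ∧ a < N := fun a ha ↦ Finset.mem_Ico.1 (hA ha)
  have hinj : Set.InjOn Int.toNat (A : Set ℤ) := fun a ha b hb hab ↦ by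
    have := hmem a ha
    have := hmem b hb
    lia
  have hrange : A.image Int.toNat ⊆ Finset.range N := fun n hn ↦ by
    obtain ⟨a, ha, rfl⟩ := Finset.mem_image.1 hn
    have := hmem a ha
    rw [Finset.mem_range]
    lia
  by_contra hno
  refine roth_3ap_theorem_nat α hα hN (A.image Int.toNat) hrange
    (by rwa [Finset.card_image_of_injOn hinj]) ?_
  rw [Finset.coe_image]
  rintro _ ⟨a, ha, rfl⟩ _ ⟨b, hb, rfl⟩ _ ⟨c, hc, rfl⟩ habc
  have := hmem a ha
  have := hmem b hb
  have := hmem c hc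
  by_contra hab
  refine hno ⟨a, b - a, by lia, ha, by simpa using hb, ?_⟩
  rwa [show a + 2 * (b - a) = c by lia]
end

section
/- There exists an absolute constant C > 0 such that for all sufficiently large N, every 3AP-free subset A ⊆ {0,1,…,N−1} satisfies |A| ≤ C·N/(log log N)^{1/11}. -/
open Finset

/-- The standard additive character `t ↦ exp (2πit)` of the real line. -/
noncomputable def expChar (t : ℝ) : ℂ := Complex.exp ((2 * Real.pi * t : ℝ) * Complex.I)

lemma expChar_add (s t : ℝ) : expChar (s + t) = expChar s * expChar t := by
  simp only [expChar, ← Complex.exp_add]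
  congr 1
  push_cast
  ring

lemma norm_expChar (t : ℝ) : ‖expChar t‖ = 1 := Complex.norm_exp_ofReal_mul_I _

lemma expChar_eq_one_iff (t : ℝ) : expChar t = 1 ↔ ∃ n : ℤ, t = n := by
  rw [expChar, Complex.exp_eq_one_iff]
  refine exists_congr fun n => ?_
  have h : (2 * Real.pi * Complex.I : ℂ) ≠ 0 := Complex.two_pi_I_ne_zero
  have h1 : ((2 * Real.pi * t : ℝ) * Complex.I : ℂ) = t * (2 * Real.pi * Complex.I) := by
    push_cast
    ring
  rw [h1, mul_left_inj' h]
  exact_mod_cast Iff.rfl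

lemma expChar_intCast (n : ℤ) : expChar n = 1 := (expChar_eq_one_iff _).2 ⟨n, rfl⟩

lemma expChar_nat_mul (r : ℕ) (t : ℝ) : expChar (r * t) = expChar t ^ r := by
  rw [expChar, expChar, ← Complex.exp_nat_mul]
  congr 1
  push_cast
  ring

lemma conj_expChar (t : ℝ) : (starRingEnd ℂ) (expChar t) = expChar (-t) := by
  rw [expChar, expChar, ← Complex.exp_conj, map_mul, Complex.conj_ofReal, Complex.conj_I]
  congr 1
  push_cast
  ring

lemma norm_expChar_sub_one_le (t : ℝ) : ‖expChar t - 1‖ ≤ 7 * |t| := by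
  have h : ‖expChar t - 1‖ ≤ ‖2 * Real.pi * t‖ := by
    rw [expChar, mul_comm]
    exact Real.norm_exp_I_mul_ofReal_sub_one_le
  refine h.trans ?_
  rw [Real.norm_eq_abs, abs_mul, abs_of_pos Real.two_pi_pos]
  have := Real.pi_lt_d2
  gcongr
  linarith

lemma sum_expChar (M : ℕ) (hM : 0 < M) (n : ℤ) :
    ∑ r ∈ range M, expChar (r * (n / M : ℝ)) = if (M : ℤ) ∣ n then (M : ℂ) else 0 := by
  have hM' : (M : ℝ) ≠ 0 := by positivity
  simp only [expChar_nat_mul]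
  have hone : expChar (n / M : ℝ) = 1 ↔ (M : ℤ) ∣ n := by
    rw [expChar_eq_one_iff]
    refine exists_congr fun c => ?_
    rw [div_eq_iff hM', mul_comm]
    exact_mod_cast Iff.rfl
  split_ifs with h
  · simp [hone.2 h]
  · have hne : expChar (n / M : ℝ) - 1 ≠ 0 := sub_ne_zero.2 (mt hone.1 h)
    have hpow : expChar (n / M : ℝ) ^ M = 1 := by
      rw [← expChar_nat_mul, mul_div_cancel₀ _ hM', expChar_intCast]
    have := geom_sum_mul (expChar (n / M : ℝ)) M
    rw [hpow, sub_self] at this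
    exact (mul_eq_zero.1 this).resolve_right hne

/-- A set of integers without nontrivial three-term arithmetic progressions. -/
def IsThreeAPFree (A : Finset ℤ) : Prop :=
  ∀ x r : ℤ, r ≠ 0 → x ∈ A → x + r ∈ A → x + 2 * r ∉ A

lemma IsThreeAPFree.eq_of_add_eq {A : Finset ℤ} (hA : IsThreeAPFree A) {x y z : ℤ}
    (hx : x ∈ A) (hy : y ∈ A) (hz : z ∈ A) (h : x + z = 2 * y) : x = y := by
  by_contra hne
  refine hA x (y - x) (by omega) hx (by simpa using hy) ?_
  rwa [show x + 2 * (y - x) = z by omega]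

/-- The indicator function of `A` minus the constant `δ`. -/
noncomputable def balanced (A : Finset ℤ) (δ : ℝ) (y : ℤ) : ℝ := (if y ∈ A then 1 else 0) - δ

lemma sum_balanced {N : ℕ} {A : Finset ℤ} (hAN : A ⊆ Ico (0 : ℤ) N) (δ : ℝ) :
    ∑ y ∈ Ico (0 : ℤ) N, balanced A δ y = #A - δ * N := by
  simp only [balanced, sum_sub_distrib, sum_ite_mem, inter_eq_right.2 hAN, sum_const,
    Int.card_Ico, nsmul_eq_mul, mul_one, sub_zero, Int.toNat_natCast]
  ring

lemma sum_ite_midpoint (S : Finset ℤ) (hS : ∀ x ∈ S, ∀ z ∈ S, ∀ y, x + z = 2 * y → y ∈ S)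
    {x z : ℤ} (hx : x ∈ S) (hz : z ∈ S) :
    ∑ y ∈ S, (if x + z = 2 * y then (1 : ℝ) else 0)
      = (1 + (x.negOnePow : ℤ) * (z.negOnePow : ℤ)) / 2 := by
  have hmul : ((x.negOnePow : ℤ) : ℝ) * (z.negOnePow : ℤ) = ((x + z).negOnePow : ℤ) := by
    rw [Int.negOnePow_add]
    push_cast
    rfl
  rw [hmul]
  rcases Int.even_or_odd (x + z) with h | h
  · rw [Int.negOnePow_even _ h]
    obtain ⟨w, hw⟩ := h
    rw [sum_eq_single_of_mem w (hS x hx z hz w (by omega)) fun y _ hy => if_neg (by omega),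
      if_pos (by omega)]
    norm_num
  · rw [Int.negOnePow_odd _ h]
    obtain ⟨w, hw⟩ := h
    rw [sum_eq_zero fun y _ => if_neg (by omega)]
    norm_num

lemma sq_card_div_two_le_sum_midpoint (N : ℕ) (A : Finset ℤ) (hA : A ⊆ Ico (0 : ℤ) N) :
    (#A : ℝ) ^ 2 / 2
      ≤ ∑ x ∈ A, ∑ z ∈ A, ∑ y ∈ Ico (0 : ℤ) N, (if x + z = 2 * y then (1 : ℝ) else 0) := by
  have hS : ∀ x ∈ Ico (0 : ℤ) N, ∀ z ∈ Ico (0 : ℤ) N, ∀ y, x + z = 2 * y → y ∈ Ico (0 : ℤ) N := by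
    intro x hx z hz y h
    simp only [mem_Ico] at *
    omega
  rw [sum_congr rfl fun x hx => sum_congr rfl fun z hz =>
    sum_ite_midpoint _ hS (hA hx) (hA hz)]
  have hsq := sq_nonneg (∑ x ∈ A, ((x.negOnePow : ℤ) : ℝ))
  have : ∑ x ∈ A, ∑ z ∈ A, (1 + ((x.negOnePow : ℤ) : ℝ) * (z.negOnePow : ℤ)) / 2
      = (#A : ℝ) ^ 2 / 2 + (∑ x ∈ A, ((x.negOnePow : ℤ) : ℝ)) ^ 2 / 2 := by
    simp only [← sum_div, sum_add_distrib, ← mul_sum, ← sum_mul, sum_const, nsmul_eq_mul]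
    ring
  rw [this]
  linarith

lemma IsThreeAPFree.sum_midpoint {A : Finset ℤ} (hA : IsThreeAPFree A) :
    ∑ x ∈ A, ∑ z ∈ A, ∑ y ∈ A, (if x + z = 2 * y then (1 : ℝ) else 0) = #A := by
  have : ∀ x ∈ A, ∑ z ∈ A, ∑ y ∈ A, (if x + z = 2 * y then (1 : ℝ) else 0) = 1 := by
    intro x hx
    rw [sum_eq_single_of_mem x hx, sum_eq_single_of_mem x hx, if_pos (by omega)]
    · exact fun y _ hy => if_neg (by omega)
    · intro z hz hzx
      refine sum_eq_zero fun y hy => if_neg fun h => hzx ?_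
      have := hA.eq_of_add_eq hx hy hz h
      omega
  rw [sum_congr rfl this]
  simp

lemma IsThreeAPFree.sum_balanced_midpoint_le {N : ℕ} {A : Finset ℤ} (hA : IsThreeAPFree A)
    (hAN : A ⊆ Ico (0 : ℤ) N) {δ : ℝ} (hδ : 0 ≤ δ) :
    ∑ x ∈ A, ∑ z ∈ A, ∑ y ∈ Ico (0 : ℤ) N, (if x + z = 2 * y then balanced A δ y else 0)
      ≤ #A - δ * ((#A : ℝ) ^ 2 / 2) := by
  have hsplit : ∀ x z : ℤ,
      ∑ y ∈ Ico (0 : ℤ) N, (if x + z = 2 * y then balanced A δ y else 0)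
        = ∑ y ∈ A, (if x + z = 2 * y then (1 : ℝ) else 0)
          - δ * ∑ y ∈ Ico (0 : ℤ) N, (if x + z = 2 * y then (1 : ℝ) else 0) := by
    intro x z
    rw [← inter_eq_right.2 hAN, ← sum_ite_mem, mul_sum, ← sum_sub_distrib,
      inter_eq_right.2 hAN]
    refine sum_congr rfl fun y _ => ?_
    unfold balanced
    split_ifs <;> simp
  simp only [hsplit, sum_sub_distrib, ← mul_sum, hA.sum_midpoint]
  have := mul_le_mul_of_nonneg_left (sq_card_div_two_le_sum_midpoint N A hAN) hδ
  linarith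

lemma sum_norm_sq_expSum (M : ℕ) (A : Finset ℤ) (hM : 0 < M)
    (hA : ∀ x ∈ A, ∀ z ∈ A, (M : ℤ) ∣ x - z → x = z) :
    ∑ r ∈ range M, ‖∑ x ∈ A, expChar (x * (r / M : ℝ))‖ ^ 2 = M * #A := by
  have key : ∑ r ∈ range M, (∑ x ∈ A, expChar (x * (r / M : ℝ))) *
      (starRingEnd ℂ) (∑ x ∈ A, expChar (x * (r / M : ℝ))) = (M * #A : ℝ) := by
    simp only [map_sum, conj_expChar, sum_mul_sum, ← expChar_add]
    rw [sum_comm]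
    have : ∀ x ∈ A, ∑ r ∈ range M, ∑ z ∈ A, expChar (x * (r / M : ℝ) + -(z * (r / M : ℝ)))
        = M := by
      intro x hx
      rw [sum_comm, sum_eq_single_of_mem x hx]
      · simp [expChar]
      · intro z hz hzx
        have h := sum_expChar M hM (x - z)
        rw [if_neg fun hd => hzx (hA x hx z hz hd).symm] at h
        rw [← h]
        refine sum_congr rfl fun r _ => ?_
        congr 1
        push_cast
        ring
    rw [sum_congr rfl this]
    simp [mul_comm]
  simp only [Complex.mul_conj, Complex.normSq_eq_norm_sq] at key
  exact_mod_cast key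

lemma sum_expSum_sq_mul (M N : ℕ) (A : Finset ℤ) (f : ℤ → ℝ) (hM : 0 < M)
    (hA : ∀ x ∈ A, ∀ z ∈ A, ∀ y ∈ Ico (0 : ℤ) N, (M : ℤ) ∣ x + z - 2 * y → x + z = 2 * y) :
    ∑ r ∈ range M, (∑ x ∈ A, expChar (x * (r / M : ℝ))) * (∑ x ∈ A, expChar (x * (r / M : ℝ))) *
      (∑ y ∈ Ico (0 : ℤ) N, (f y : ℂ) * expChar (y * (-2 * (r / M) : ℝ)))
    = ((M * ∑ x ∈ A, ∑ z ∈ A, ∑ y ∈ Ico (0 : ℤ) N, if x + z = 2 * y then f y else 0 : ℝ) : ℂ) := by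
  simp only [mul_assoc]
  simp only [sum_mul_sum]
  simp only [mul_sum, Complex.ofReal_sum]
  rw [sum_comm]
  refine sum_congr rfl fun x hx => ?_
  rw [sum_comm]
  refine sum_congr rfl fun z hz => ?_
  rw [sum_comm]
  refine sum_congr rfl fun y hy => ?_
  have h := sum_expChar M hM (x + z - 2 * y)
  have hiff : (M : ℤ) ∣ x + z - 2 * y ↔ x + z = 2 * y :=
    ⟨hA x hx z hz y hy, fun h => by simp [h]⟩
  have : ∀ r ∈ range M, expChar (x * (r / M : ℝ)) * (expChar (z * (r / M : ℝ)) *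
      (f y * expChar (y * (-2 * (r / M) : ℝ))))
      = f y * expChar (r * ((x + z - 2 * y : ℤ) / M : ℝ)) := by
    intro r _
    rw [mul_left_comm _ (f y : ℂ), mul_left_comm _ (f y : ℂ), ← expChar_add, ← expChar_add]
    congr 2
    push_cast
    ring
  rw [sum_congr rfl this, ← mul_sum, h]
  simp only [hiff]
  split_ifs <;> simp [mul_comm]

/-- The balanced function of a dense three-AP-free set has a large exponential sum. -/
lemma IsThreeAPFree.exists_large_expSum {N : ℕ} {A : Finset ℤ} (hA : IsThreeAPFree A)
    (hAN : A ⊆ Ico (0 : ℤ) N) {δ : ℝ} (hδ : 0 < δ) (hcard : δ * N ≤ #A) (hN : 4 ≤ δ ^ 2 * N) :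
    ∃ α : ℝ, δ ^ 2 / 4 * N
      ≤ ‖∑ y ∈ Ico (0 : ℤ) N, (balanced A δ y : ℂ) * expChar (y * α)‖ := by
  by_contra! hlt
  have hmem : ∀ x ∈ A, 0 ≤ x ∧ x < N := fun x hx => by simpa using hAN hx
  set M := 2 * N + 1 with hMdef
  have hM : 0 < M := by omega
  have hparseval := sum_norm_sq_expSum M A hM (by
    intro x hx z hz hd
    have := hmem x hx
    have := hmem z hz
    have := Int.eq_zero_of_abs_lt_dvd hd (by rw [abs_lt]; omega)
    omega)
  have hconv := sum_expSum_sq_mul M N A (balanced A δ) hM (by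
    intro x hx z hz y hy hd
    have := hmem x hx
    have := hmem z hz
    rw [mem_Ico] at hy
    have := Int.eq_zero_of_abs_lt_dvd hd (by rw [abs_lt]; omega)
    omega)
  have hcount := hA.sum_balanced_midpoint_le hAN hδ.le
  have hM' : (0 : ℝ) < M := by exact_mod_cast hM
  have hNpos : (0 : ℝ) < N := by
    by_contra! h
    nlinarith [sq_nonneg δ]
  have hApos : (0 : ℝ) < #A := lt_of_lt_of_le (by positivity) hcard
  set T := ∑ x ∈ A, ∑ z ∈ A, ∑ y ∈ Ico (0 : ℤ) N, if x + z = 2 * y then balanced A δ y else 0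
  have hupper : M * |T| < M * #A * (δ ^ 2 / 4 * N) := by
    calc M * |T| = ‖((M * T : ℝ) : ℂ)‖ := by
          rw [Complex.norm_real, Real.norm_eq_abs, abs_mul, abs_of_pos hM']
      _ ≤ ∑ r ∈ range M, ‖∑ x ∈ A, expChar (x * (r / M : ℝ))‖ ^ 2 *
            ‖∑ y ∈ Ico (0 : ℤ) N, (balanced A δ y : ℂ) * expChar (y * (-2 * (r / M) : ℝ))‖ := by
          rw [← hconv]
          refine (norm_sum_le _ _).trans (le_of_eq (sum_congr rfl fun r _ => ?_))
          rw [norm_mul, norm_mul, sq]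
      _ < ∑ r ∈ range M, ‖∑ x ∈ A, expChar (x * (r / M : ℝ))‖ ^ 2 * (δ ^ 2 / 4 * N) := by
          refine sum_lt_sum (fun r _ => by gcongr; exact (hlt _).le) ⟨0, by simpa using hM, ?_⟩
          refine mul_lt_mul_of_pos_left (hlt _) ?_
          have : expChar 0 = 1 := by simpa using expChar_intCast 0
          simp only [Nat.cast_zero, zero_div, mul_zero, this, sum_const, nsmul_eq_mul, mul_one,
            Complex.norm_natCast]
          positivity
      _ = M * #A * (δ ^ 2 / 4 * N) := by rw [← sum_mul, hparseval]
  rw [mul_assoc, mul_lt_mul_iff_right₀ hM'] at hupper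
  have h1 := neg_abs_le T
  have h2 : (#A : ℝ) * (δ * (δ * N)) ≤ #A * (δ * #A) := by gcongr
  have h3 := mul_le_mul_of_nonneg_left hN hApos.le
  nlinarith

lemma sum_Ico_shift {E : Type*} [AddCommMonoid E] (g : ℤ → E) (N D t : ℤ)
    (hg : ∀ y, y ∉ Ico 0 N → g y = 0) (ht : 0 ≤ t) (htD : t ≤ D) :
    ∑ x ∈ Ico (-D) N, g (x + t) = ∑ y ∈ Ico 0 N, g y := by
  rw [← sum_image (f := g) (g := fun x => x + t) (fun a _ b _ h => by simpa using h)]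
  symm
  refine sum_subset (fun y hy => ?_) fun y _ hy => hg y hy
  rw [mem_Ico] at hy
  exact mem_image.2 ⟨y - t, by rw [mem_Ico]; omega, by ring⟩

/-- A bounded function of mean zero with a large exponential sum is biased on a long
arithmetic progression. -/
lemma exists_progression_of_large_expSum {N m : ℕ} {f : ℤ → ℝ} {η α : ℝ}
    (hsupp : ∀ y, y ∉ Ico (0 : ℤ) N → f y = 0) (hbd : ∀ y, |f y| ≤ 1)
    (hmean : 0 ≤ ∑ y ∈ Ico (0 : ℤ) N, f y) (hm : 0 < m) (hmN : m ^ 4 ≤ N) (hη : 16 ≤ η * m)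
    (hα : η * N ≤ ‖∑ y ∈ Ico (0 : ℤ) N, (f y : ℂ) * expChar (y * α)‖) :
    ∃ q x : ℤ, 0 < q ∧ 0 ≤ x ∧ x + m * q < N ∧
      η / 8 * m ≤ ∑ j ∈ range m, f (x + j * q) := by
  obtain ⟨q, hq, hqm, hqα⟩ := Real.exists_nat_abs_mul_sub_round_le α (n := m ^ 2) (by positivity)
  by_contra! hlt
  have hm' : (0 : ℝ) < m := by exact_mod_cast hm
  have hmN' : (m : ℝ) ^ 4 ≤ N := by exact_mod_cast hmN
  have hqm' : (q : ℝ) ≤ m ^ 2 := by exact_mod_cast hqm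
  have hNpos : (0 : ℝ) < N := lt_of_lt_of_le (by positivity) hmN'
  have hηpos : 0 < η := by
    by_contra! h
    nlinarith
  have hshift : ∀ {E : Type} [AddCommMonoid E] (g : ℤ → E),
      (∀ y, y ∉ Ico (0 : ℤ) N → g y = 0) →
      ∑ x ∈ Ico (-(m * q : ℤ)) N, ∑ j ∈ range m, g (x + j * q)
        = m • ∑ y ∈ Ico (0 : ℤ) N, g y := by
    intro E _ g hg
    have hj : ∀ j ∈ range m,
        ∑ x ∈ Ico (-(m * q : ℤ)) N, g (x + j * q) = ∑ y ∈ Ico (0 : ℤ) N, g y := by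
      intro j hj
      have := (mem_range.1 hj).le
      exact sum_Ico_shift g N (m * q) (j * q) hg (by positivity) (by gcongr)
    rw [sum_comm, sum_congr rfl hj]
    simp
  set F : ℤ → ℝ := fun x => ∑ j ∈ range m, f (x + j * q) with hF
  have hFm : ∀ x, F x ≤ m := fun x =>
    (sum_le_card_nsmul _ _ 1 fun j _ => (le_abs_self _).trans (hbd _)).trans (by simp)
  have hFsum : 0 ≤ ∑ x ∈ Ico (-(m * q : ℤ)) N, F x := by
    rw [hF, hshift f hsupp]
    positivity
  have hpos : ∑ x ∈ Ico (-(m * q : ℤ)) N, max (F x) 0 ≤ N * (η / 8 * m) + 2 * m ^ 2 * q := by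
    have hpt : ∀ x ∈ Ico (-(m * q : ℤ)) N, max (F x) 0 ≤
        (if x ∈ Ico (0 : ℤ) N then η / 8 * m else 0)
          + ((if x ∈ Ico (-(m * q : ℤ)) 0 then (m : ℝ) else 0)
          + if x ∈ Ico (N - m * q : ℤ) N then (m : ℝ) else 0) := by
      intro x hx
      have hc : 0 ≤ η / 8 * m := by positivity
      have := hFm x
      have := hlt q x (by exact_mod_cast hq)
      rw [mem_Ico] at hx
      simp only [mem_Ico]
      split_ifs <;> apply max_le <;> first
        | positivity
        | linarith
        | (have := this (by omega) (by omega); simp only [hF]; linarith)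
        | omega
    refine (sum_le_sum hpt).trans ?_
    have hcount : ∀ (a b : ℤ) (n : ℕ) (c : ℝ), 0 ≤ c → b - a = n →
        ∑ x ∈ Ico (-(m * q : ℤ)) N, (if x ∈ Ico a b then c else 0) ≤ n * c := by
      intro a b n c hc hab
      rw [sum_ite_mem, sum_const, nsmul_eq_mul]
      gcongr
      refine (card_le_card inter_subset_right).trans ?_
      rw [Int.card_Ico]
      omega
    rw [sum_add_distrib, sum_add_distrib]
    have h1 := hcount 0 N N (η / 8 * m) (by positivity) (by simp)
    have h2 := hcount (-(m * q : ℤ)) 0 (m * q) m hm'.le (by push_cast; ring)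
    have h3 := hcount (N - m * q : ℤ) N (m * q) m hm'.le (by push_cast; ring)
    push_cast at h2 h3
    linarith
  have habs : ∑ x ∈ Ico (-(m * q : ℤ)) N, |F x| ≤ 2 * (N * (η / 8 * m) + 2 * m ^ 2 * q) := by
    have : ∀ x ∈ Ico (-(m * q : ℤ)) N, |F x| = 2 * max (F x) 0 - F x := by
      intro x _
      rcases le_total (F x) 0 with h | h
      · rw [abs_of_nonpos h, max_eq_right h]
        ring
      · rw [abs_of_nonneg h, max_eq_left h]
        ring
    rw [sum_congr rfl this, sum_sub_distrib, ← mul_sum]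
    linarith
  have hphase : ∀ j ∈ range m, ‖expChar (j * q * α) - 1‖ ≤ 7 / m := by
    intro j hj
    have hjm : (j : ℝ) ≤ m := by exact_mod_cast (mem_range.1 hj).le
    have : expChar (j * q * α) = expChar (j * (q * α - round (q * α))) := by
      have h := expChar_add (j * (q * α - round (q * α))) ((j * round (q * α) : ℤ) : ℝ)
      rw [expChar_intCast, mul_one] at h
      rw [← h]
      congr 1
      push_cast
      ring
    rw [this]
    refine (norm_expChar_sub_one_le _).trans ?_
    rw [abs_mul, Nat.abs_cast]
    calc 7 * (j * |q * α - round (q * α)|) ≤ 7 * (m * (1 / ((m ^ 2 : ℕ) + 1))) := by gcongr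
      _ ≤ 7 * (m * (1 / (m ^ 2 : ℝ))) := by
          gcongr
          push_cast
          linarith
      _ = 7 / m := by field_simp
  have hnorm : m * ‖∑ y ∈ Ico (0 : ℤ) N, (f y : ℂ) * expChar (y * α)‖
      ≤ ∑ x ∈ Ico (-(m * q : ℤ)) N, (|F x| + ∑ j ∈ range m, |f (x + j * q)| * (7 / m)) := by
    have h := hshift (fun y => (f y : ℂ) * expChar (y * α)) fun y hy => by simp [hsupp y hy]
    rw [nsmul_eq_mul] at h
    rw [← Complex.norm_natCast (n := m), ← norm_mul, ← h, Complex.norm_natCast]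
    refine (norm_sum_le _ _).trans (sum_le_sum fun x _ => ?_)
    have hfac : ∑ j ∈ range m, (f (x + j * q) : ℂ) * expChar ((x + j * q : ℤ) * α)
        = expChar (x * α) * ((F x : ℂ)
          + ∑ j ∈ range m, (f (x + j * q) : ℂ) * (expChar (j * q * α) - 1)) := by
      rw [hF, Complex.ofReal_sum, ← sum_add_distrib, mul_sum]
      refine sum_congr rfl fun j _ => ?_
      rw [show ((x + j * q : ℤ) : ℝ) * α = x * α + j * q * α by push_cast; ring, expChar_add]
      ring
    rw [hfac, norm_mul, norm_expChar, one_mul]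
    refine (norm_add_le _ _).trans (add_le_add (by simp) ((norm_sum_le _ _).trans ?_))
    refine sum_le_sum fun j hj => ?_
    rw [norm_mul, Complex.norm_real, Real.norm_eq_abs]
    gcongr
    exact hphase j hj
  have herr : ∑ x ∈ Ico (-(m * q : ℤ)) N, ∑ j ∈ range m, |f (x + j * q)| * (7 / m) ≤ 7 * N := by
    rw [hshift (fun y => |f y| * (7 / m)) fun y hy => by simp [hsupp y hy], nsmul_eq_mul,
      ← sum_mul]
    have : ∑ y ∈ Ico (0 : ℤ) N, |f y| ≤ N :=
      (sum_le_card_nsmul _ _ 1 fun y _ => hbd y).trans (by simp)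
    calc m * ((∑ y ∈ Ico (0 : ℤ) N, |f y|) * (7 / m)) ≤ m * (N * (7 / m)) := by gcongr
      _ = 7 * N := by field_simp
  rw [sum_add_distrib] at hnorm
  have h1 : m * (η * N) ≤ 2 * (N * (η / 8 * m) + 2 * m ^ 2 * q) + 7 * N := by
    have := mul_le_mul_of_nonneg_left hα hm'.le
    linarith
  have h2 : (m : ℝ) ^ 2 * q ≤ N := by
    calc (m : ℝ) ^ 2 * q ≤ (m : ℝ) ^ 2 * m ^ 2 := by gcongr
      _ = (m : ℝ) ^ 4 := by ring
      _ ≤ N := hmN'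
  have h3 := mul_le_mul_of_nonneg_right hη hNpos.le
  linarith

/-- The density increment step for three-AP-free sets. -/
lemma IsThreeAPFree.exists_density_increment {N m : ℕ} {A : Finset ℤ} (hA : IsThreeAPFree A)
    (hAN : A ⊆ Ico (0 : ℤ) N) {δ : ℝ} (hδ : 0 < δ) (hδ1 : δ ≤ 1) (hcard : δ * N ≤ #A)
    (hm : 64 ≤ δ ^ 2 * m) (hmN : m ^ 4 ≤ N) :
    ∃ B ⊆ Ico (0 : ℤ) m, IsThreeAPFree B ∧ (δ + δ ^ 2 / 32) * m ≤ #B := by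
  have hmpos : 0 < m := by
    rcases Nat.eq_zero_or_pos m with rfl | h
    · norm_num at hm
    · exact h
  have hmN1 : m ≤ N := (Nat.le_self_pow (by norm_num) m).trans hmN
  have hN : 4 ≤ δ ^ 2 * N := by
    have : δ ^ 2 * m ≤ δ ^ 2 * N := by gcongr
    linarith
  obtain ⟨α, hα⟩ := hA.exists_large_expSum hAN hδ hcard hN
  set f : ℤ → ℝ := fun y => if y ∈ Ico (0 : ℤ) N then balanced A δ y else 0 with hf
  have hfeq : ∀ y ∈ Ico (0 : ℤ) N, f y = balanced A δ y := fun y hy => if_pos hy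
  obtain ⟨q, x, hq, hx, hxN, hbias⟩ := exists_progression_of_large_expSum (f := f) (m := m)
    (η := δ ^ 2 / 4) (α := α) (fun y hy => if_neg hy) (by
      intro y
      simp only [hf, balanced]
      rw [abs_le]
      split_ifs <;> constructor <;> linarith) (by
      rw [sum_congr rfl hfeq, sum_balanced hAN]
      linarith) hmpos hmN (by linarith) (by
      rw [sum_congr rfl fun y hy => by rw [hfeq y hy]]
      exact hα)
  refine ⟨{j ∈ Ico (0 : ℤ) m | x + j * q ∈ A}, filter_subset _ _, ?_, ?_⟩
  · intro a r hr h1 h2 h3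
    simp only [mem_filter] at h1 h2 h3
    refine hA (x + a * q) (r * q) (mul_ne_zero hr hq.ne') h1.2 ?_ ?_
    · convert h2.2 using 1
      ring
    · convert h3.2 using 1
      ring
  · have himage : Ico (0 : ℤ) m = (range m).image (fun j : ℕ => (j : ℤ)) := by
      ext j
      simp only [mem_Ico, mem_image, mem_range]
      exact ⟨fun h => ⟨j.toNat, by omega, by omega⟩, by omega⟩
    have hcardB : (#{j ∈ Ico (0 : ℤ) m | x + j * q ∈ A} : ℝ)
        = ∑ j ∈ range m, if x + (j : ℤ) * q ∈ A then (1 : ℝ) else 0 := by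
      rw [card_filter, Nat.cast_sum, himage, sum_image (by simp)]
      simp
    have hsum : ∑ j ∈ range m, f (x + j * q)
        = (∑ j ∈ range m, if x + (j : ℤ) * q ∈ A then (1 : ℝ) else 0) - δ * m := by
      rw [sum_congr rfl fun j hj => hfeq _ ?_]
      · simp [balanced, sum_sub_distrib, mul_comm]
      · have : (j : ℤ) * q ≤ m * q := by
          have := mem_range.1 hj
          gcongr
        rw [mem_Ico]
        constructor
        · positivity
        · linarith
    rw [hcardB]
    linarith

lemma IsThreeAPFree.density_add_le_one {m : ℕ} {δ : ℝ} (hδ : 0 < δ) (hm : 64 ≤ δ ^ 2 * m) (k : ℕ) :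
    ∀ {N : ℕ} {A : Finset ℤ} {δ' : ℝ}, IsThreeAPFree A → A ⊆ Ico (0 : ℤ) N → δ ≤ δ' →
      δ' * N ≤ #A → m ^ 4 ^ k ≤ N → δ' + k * (δ ^ 2 / 32) ≤ 1 := by
  have hmpos : 0 < m := by
    rcases Nat.eq_zero_or_pos m with rfl | h
    · norm_num at hm
    · exact h
  have hle : ∀ {N : ℕ} {A : Finset ℤ} {δ' : ℝ}, A ⊆ Ico (0 : ℤ) N → δ' * N ≤ #A → 0 < N →
      δ' ≤ 1 := by
    intro N A δ' hAN hcard hN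
    have h1 : (#A : ℝ) ≤ N := by
      have := card_le_card hAN
      rw [Int.card_Ico] at this
      exact_mod_cast (by omega : #A ≤ N)
    have h2 : (0 : ℝ) < N := by exact_mod_cast hN
    nlinarith
  induction k with
  | zero =>
    intro N A δ' _ hAN _ hcard hmN
    simpa using hle hAN hcard (by simp at hmN; omega)
  | succ k ih =>
    intro N A δ' hA hAN hδδ' hcard hmN
    have hNpos : 0 < N := lt_of_lt_of_le (by positivity) hmN
    have hpow : (m : ℝ) ≤ (m ^ 4 ^ k : ℕ) := by
      exact_mod_cast Nat.le_self_pow (by positivity) m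
    have hsq : δ ^ 2 ≤ δ' ^ 2 := by gcongr
    obtain ⟨B, hBm, hB, hBcard⟩ := hA.exists_density_increment (m := m ^ 4 ^ k) hAN
      (hδ.trans_le hδδ') (hle hAN hcard hNpos) hcard
      (hm.trans (by gcongr)) (by rwa [← pow_mul, ← pow_succ])
    have := ih hB hBm (by nlinarith [sq_nonneg δ']) hBcard le_rfl
    push_cast
    linarith

lemma IsThreeAPFree.sq_density_mul_log_log_le {N : ℕ} {A : Finset ℤ} (hA : IsThreeAPFree A)
    (hAN : A ⊆ Ico (0 : ℤ) N) {δ : ℝ} (hδ : 0 < δ) (hδ1 : δ ≤ 1) (hcard : δ * N ≤ #A)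
    (hN : 1 < N) : δ ^ 2 * Real.log (Real.log N) ≤ 131 := by
  set k := ⌊32 / δ ^ 2⌋₊ + 1 with hk
  set m := ⌈64 / δ ^ 2⌉₊ with hm
  have hδ2 : 0 < δ ^ 2 := by positivity
  have hδ21 : δ ^ 2 ≤ 1 := pow_le_one₀ hδ.le hδ1
  have hk_gt : 32 / δ ^ 2 < k := by
    rw [hk, Nat.cast_add_one]
    exact Nat.lt_floor_add_one _
  have hk_le : k * δ ^ 2 ≤ 32 + δ ^ 2 := by
    have : (k : ℝ) ≤ 32 / δ ^ 2 + 1 := by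
      rw [hk]
      push_cast
      gcongr
      exact Nat.floor_le (by positivity)
    calc k * δ ^ 2 ≤ (32 / δ ^ 2 + 1) * δ ^ 2 := by gcongr
      _ = 32 + δ ^ 2 := by field_simp
  have hm_ge : 64 ≤ δ ^ 2 * m := by
    have := Nat.le_ceil (64 / δ ^ 2)
    rwa [div_le_iff₀' hδ2] at this
  have hm_le : m * δ ^ 2 ≤ 64 + δ ^ 2 := by
    calc m * δ ^ 2 ≤ (64 / δ ^ 2 + 1) * δ ^ 2 := by
          gcongr
          exact (Nat.ceil_lt_add_one (by positivity)).le
      _ = 64 + δ ^ 2 := by field_simp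
  have hNlt : N < m ^ 4 ^ k := by
    by_contra! h
    have h1 := density_add_le_one hδ hm_ge k hA hAN le_rfl hcard h
    rw [div_lt_iff₀ hδ2] at hk_gt
    linarith
  have hmpos : (0 : ℝ) < m := by
    by_contra! h
    nlinarith
  have hlogN : 0 < Real.log N := Real.log_pos (by exact_mod_cast hN)
  have hlog : Real.log N ≤ 4 ^ k * m := by
    calc Real.log N ≤ Real.log ((m : ℝ) ^ 4 ^ k) :=
          Real.log_le_log (by positivity) (by exact_mod_cast hNlt.le)
      _ = 4 ^ k * Real.log m := by
          rw [Real.log_pow]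
          push_cast
          rfl
      _ ≤ 4 ^ k * m := by
          gcongr
          exact Real.log_le_self hmpos.le
  have hloglog : Real.log (Real.log N) ≤ 2 * k + m := by
    calc Real.log (Real.log N) ≤ Real.log (4 ^ k * m) := Real.log_le_log hlogN hlog
      _ = k * (2 * Real.log 2) + Real.log m := by
          rw [Real.log_mul (by positivity) hmpos.ne', Real.log_pow,
            show (4 : ℝ) = 2 ^ 2 by norm_num, Real.log_pow]
          push_cast
          rfl
      _ ≤ k * (2 * 1) + m := by
          gcongr
          · linarith [Real.log_two_lt_d9]
          · exact Real.log_le_self hmpos.le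
      _ = 2 * k + m := by ring
  calc δ ^ 2 * Real.log (Real.log N) ≤ δ ^ 2 * (2 * k + m) := by gcongr
    _ ≤ 131 := by linarith

/-- There exists an absolute constant `C > 0` such that for all sufficiently
large `N`, every 3AP-free subset `A ⊆ {0,1,…,N−1}` satisfies
`|A| ≤ C·N/(log log N)^(1/11)`. -/
theorem roth_quantitative :
    ∃ C : ℝ, 0 < C ∧ ∃ N₀ : ℕ, ∀ N : ℕ, N₀ ≤ N →
      ∀ A : Finset ℤ, A ⊆ Finset.Ico (0 : ℤ) (N : ℤ) →
        (¬ ∃ x r : ℤ, r ≠ 0 ∧ x ∈ A ∧ x + r ∈ A ∧ x + 2 * r ∈ A) →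
        (A.card : ℝ) ≤ C * N / Real.log (Real.log N) ^ ((1 : ℝ) / 11) := by
  refine ⟨131, by norm_num, ⌈Real.exp (Real.exp 1)⌉₊, fun N hN A hAN hfree => ?_⟩
  have hA : IsThreeAPFree A := fun x r hr h1 h2 h3 => hfree ⟨x, r, hr, h1, h2, h3⟩
  have hexp : Real.exp (Real.exp 1) ≤ N := Nat.ceil_le.1 hN
  have hN1 : (1 : ℝ) < N := (Real.one_lt_exp_iff.2 (Real.exp_pos 1)).trans_le hexp
  have hlog : Real.exp 1 ≤ Real.log N := (Real.le_log_iff_exp_le (by linarith)).2 hexp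
  have hloglog : 1 ≤ Real.log (Real.log N) :=
    (Real.le_log_iff_exp_le ((Real.exp_pos 1).trans_le hlog)).2 hlog
  set L := Real.log (Real.log N)
  have hL : 0 < L ^ ((1 : ℝ) / 11) := by positivity
  set δ : ℝ := #A / N with hδ
  have hNpos : (0 : ℝ) < N := by linarith
  have hcard : (#A : ℝ) = δ * N := by
    rw [hδ]
    field_simp
  suffices h : δ * L ^ ((1 : ℝ) / 11) ≤ 131 by
    rw [le_div_iff₀ hL, hcard]
    calc δ * N * L ^ ((1 : ℝ) / 11) = δ * L ^ ((1 : ℝ) / 11) * N := by ring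
      _ ≤ 131 * N := by gcongr
  have hδnonneg : 0 ≤ δ := div_nonneg (Nat.cast_nonneg _) (Nat.cast_nonneg _)
  rcases hδnonneg.eq_or_lt with h0 | hδpos
  · rw [← h0, zero_mul]
    norm_num
  have hδ1 : δ ≤ 1 := by
    have := card_le_card hAN
    rw [Int.card_Ico] at this
    rw [hδ, div_le_one hNpos]
    exact_mod_cast (by omega : #A ≤ N)
  have hbound := hA.sq_density_mul_log_log_le hAN hδpos hδ1 hcard.ge (by exact_mod_cast hN1)
  have hroot : (L ^ ((1 : ℝ) / 11)) ^ 11 = L := by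
    rw [← Real.rpow_natCast, ← Real.rpow_mul (by linarith)]
    norm_num
  refine le_of_pow_le_pow_left₀ (n := 11) (by norm_num) (by norm_num) ?_
  calc (δ * L ^ ((1 : ℝ) / 11)) ^ 11 = δ ^ 11 * L := by rw [mul_pow, hroot]
    _ ≤ δ ^ 2 * L := by
        gcongr ?_ * L
        exact pow_le_pow_of_le_one hδpos.le hδ1 (by norm_num)
    _ ≤ 131 := hbound
    _ ≤ 131 ^ 11 := le_self_pow₀ (by norm_num) (by norm_num)
end

section
/- Let m be a prime, g : ZMod m → ℝ, and h, k ∈ ZMod m with h ≠ 0 and k ≠ 0. Then ∑_{d ∈ ZMod m} R_g(h·d)·R_g(k·d) ≥ 0. -/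
/-- The autocorrelation `R_g(t) = ∑_{x ∈ ZMod m} g(x)·g(x+t)`. -/
def autocorr {m : ℕ} [NeZero m] (g : ZMod m → ℝ) (t : ZMod m) : ℝ :=
  ∑ x : ZMod m, g x * g (x + t)

/-- The correlation of two autocorrelations is a sum of squares of cross-correlations. -/
theorem sum_autocorr_mul_autocorr {m : ℕ} [NeZero m] (f g : ZMod m → ℝ) :
    ∑ d, autocorr f d * autocorr g d = ∑ c, (∑ u, f u * g (u + c)) ^ 2 := by
  have hL (d : ZMod m) : autocorr f d * autocorr g d =
      ∑ u, ∑ c, f u * f (u + d) * (g (u + c) * g (u + c + d)) := by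
    rw [autocorr, Finset.sum_mul]
    refine Finset.sum_congr rfl fun u _ => ?_
    rw [autocorr, Finset.mul_sum]
    exact (Equiv.sum_comp (Equiv.addLeft u) fun v => f u * f (u + d) * (g v * g (v + d))).symm
  have hR (c : ZMod m) : (∑ u, f u * g (u + c)) ^ 2 =
      ∑ u, ∑ d, f u * f (u + d) * (g (u + c) * g (u + c + d)) := by
    rw [sq, Finset.sum_mul]
    refine Finset.sum_congr rfl fun u _ => ?_
    rw [Finset.mul_sum, ← Equiv.sum_comp (Equiv.addLeft u)]
    refine Finset.sum_congr rfl fun d _ => ?_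
    rw [Equiv.coe_addLeft, add_right_comm u d c]
    ring
  simp_rw [hL, hR]
  rw [Finset.sum_comm]
  conv_rhs => rw [Finset.sum_comm]
  exact Finset.sum_congr rfl fun u _ => Finset.sum_comm

/-- Dilating the argument of an autocorrelation by a unit amounts to dilating the function. -/
theorem autocorr_mul_of_isUnit {m : ℕ} [NeZero m] (g : ZMod m → ℝ) {h : ZMod m}
    (hh : IsUnit h) (d : ZMod m) :
    autocorr g (h * d) = autocorr (fun x => g (h * x)) d := by
  obtain ⟨u, rfl⟩ := hh
  simp only [autocorr, mul_add]
  exact (Equiv.sum_comp u.mulLeft fun x => g x * g (x + u * d)).symm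

/-- For a prime `m`, a function `g : ZMod m → ℝ` and nonzero `h, k ∈ ZMod m`,
one has `∑_d R_g(h·d)·R_g(k·d) ≥ 0`. -/
theorem autocorr_dilate_sum_nonneg (m : ℕ) [NeZero m] (hm : Nat.Prime m)
    (g : ZMod m → ℝ) (h k : ZMod m) (hh : h ≠ 0) (hk : k ≠ 0) :
    0 ≤ ∑ d : ZMod m, autocorr g (h * d) * autocorr g (k * d) := by
  have : Fact m.Prime := ⟨hm⟩
  simp_rw [autocorr_mul_of_isUnit g hh.isUnit, autocorr_mul_of_isUnit g hk.isUnit]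
  rw [sum_autocorr_mul_autocorr]
  positivity
end

section
/- Let m be a prime, let F, h₁, h₂ : ZMod m → ℝ with |h₁(x)| ≤ 1 and |h₂(x)| ≤ 1 for all x, and let a, b ∈ ZMod m with a ≠ 0, b ≠ 0, and a ≠ b. Then ( ∑_{y,r ∈ ZMod m} F(y)·h₁(y + a·r)·h₂(y + b·r) )⁴ ≤ m⁵·E(F). -/
/-- The energy `E(g) = ∑_{t ∈ ZMod m} R_g(t)²`. -/
def energy {m : ℕ} [NeZero m] (g : ZMod m → ℝ) : ℝ :=
  ∑ t : ZMod m, autocorr g t ^ 2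

/-- Cauchy–Schwarz against a weight bounded by `1`. -/
theorem sq_sum_mul_le_card_mul_sum_sq {ι : Type*} [Fintype ι] (h f : ι → ℝ)
    (hh : ∀ i, |h i| ≤ 1) :
    (∑ i, h i * f i) ^ 2 ≤ (Fintype.card ι : ℝ) * ∑ i, f i ^ 2 := by
  refine (Finset.sum_mul_sq_le_sq_mul_sq Finset.univ h f).trans ?_
  refine mul_le_mul_of_nonneg_right ?_ (Finset.sum_nonneg fun i _ => sq_nonneg _)
  calc ∑ i, h i ^ 2 ≤ ∑ _i : ι, (1 : ℝ) :=
        Finset.sum_le_sum fun i _ => (sq_le_one_iff_abs_le_one _).2 (hh i)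
    _ = Fintype.card ι := by simp

/-- A bilinear form with weights bounded by `1` is controlled by the box norm of its kernel. -/
theorem bilinear_pow_four_le_box {ι κ : Type*} [Fintype ι] [Fintype κ]
    (G : ι → κ → ℝ) (h : ι → ℝ) (k : κ → ℝ)
    (hh : ∀ i, |h i| ≤ 1) (hk : ∀ j, |k j| ≤ 1) :
    (∑ i, h i * ∑ j, k j * G i j) ^ 4
      ≤ (Fintype.card ι : ℝ) ^ 2 * ((Fintype.card κ : ℝ) ^ 2 *
        ∑ j, ∑ j', (∑ i, G i j * G i j') ^ 2) := by
  have expand : ∑ i, (∑ j, k j * G i j) ^ 2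
      = ∑ p : κ × κ, (k p.1 * k p.2) * ∑ i, G i p.1 * G i p.2 := by
    simp_rw [sq, Finset.sum_mul_sum, Fintype.sum_prod_type, Finset.mul_sum]
    rw [Finset.sum_comm]
    refine Finset.sum_congr rfl fun j _ => ?_
    rw [Finset.sum_comm]
    exact Finset.sum_congr rfl fun j' _ => Finset.sum_congr rfl fun i _ => by ring
  have hkk : ∀ p : κ × κ, |k p.1 * k p.2| ≤ 1 := fun p => by
    rw [abs_mul]
    exact mul_le_one₀ (hk _) (abs_nonneg _) (hk _)
  have second := sq_sum_mul_le_card_mul_sum_sq (fun p : κ × κ => k p.1 * k p.2)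
    (fun p => ∑ i, G i p.1 * G i p.2) hkk
  rw [← expand, Fintype.card_prod, Fintype.sum_prod_type, Nat.cast_mul, ← sq] at second
  calc (∑ i, h i * ∑ j, k j * G i j) ^ 4
      = ((∑ i, h i * ∑ j, k j * G i j) ^ 2) ^ 2 := by ring
    _ ≤ ((Fintype.card ι : ℝ) * ∑ i, (∑ j, k j * G i j) ^ 2) ^ 2 :=
        pow_le_pow_left₀ (sq_nonneg _) (sq_sum_mul_le_card_mul_sum_sq h _ hh) 2
    _ = (Fintype.card ι : ℝ) ^ 2 * (∑ i, (∑ j, k j * G i j) ^ 2) ^ 2 := mul_pow _ _ _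
    _ ≤ _ := mul_le_mul_of_nonneg_left second (sq_nonneg _)

/-- Reindexing a sum over `ZMod m`, `m` prime, along a nonconstant affine map. -/
theorem ZMod.sum_comp_affine {m : ℕ} [NeZero m] (hm : m.Prime) (f : ZMod m → ℝ)
    {c : ZMod m} (hc : c ≠ 0) (d : ZMod m) : ∑ x, f (c * x + d) = ∑ x, f x := by
  have := Fact.mk hm
  exact Equiv.sum_comp ((Equiv.mulLeft₀ c hc).trans (Equiv.addRight d)) f

/-- The box norm of the kernel `F (c * u + d * v)` is the energy of `F`, up to normalization. -/
theorem sum_box_affine_eq_energy {m : ℕ} [NeZero m] (hm : m.Prime) (F : ZMod m → ℝ)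
    {c d : ZMod m} (hc : c ≠ 0) (hd : d ≠ 0) :
    ∑ v, ∑ v', (∑ u, F (c * u + d * v) * F (c * u + d * v')) ^ 2 = m * energy F := by
  have corr : ∀ v v', ∑ u, F (c * u + d * v) * F (c * u + d * v')
      = autocorr F (d * v' + -(d * v)) := fun v v' => by
    rw [autocorr, ← ZMod.sum_comp_affine hm (fun x => F x * F (x + (d * v' + -(d * v)))) hc (d * v)]
    refine Finset.sum_congr rfl fun u _ => ?_
    rw [show c * u + d * v + (d * v' + -(d * v)) = c * u + d * v' by ring]
  simp_rw [corr, fun v => ZMod.sum_comp_affine hm (fun t => autocorr F t ^ 2) hd (-(d * v))]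
  simp [energy, ZMod.card]

/-- The change of variables `u = y + a * r`, `v = y + b * r`. -/
theorem sum_bilinear_eq_sum_affine {m : ℕ} [NeZero m] (hm : m.Prime) (F h₁ h₂ : ZMod m → ℝ)
    {a b : ZMod m} (hab : a ≠ b) :
    ∑ y, ∑ r, F y * h₁ (y + a * r) * h₂ (y + b * r)
      = ∑ u, h₁ u * ∑ v, h₂ v * F (b * (b - a)⁻¹ * u + -(a * (b - a)⁻¹) * v) := by
  have := Fact.mk hm
  have hba : b - a ≠ 0 := sub_ne_zero.2 hab.symm
  have shift : ∀ r, ∑ y, F y * h₁ (y + a * r) * h₂ (y + b * r)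
      = ∑ u, F (u - a * r) * h₁ u * h₂ (u + (b - a) * r) := fun r => by
    rw [← Equiv.sum_comp (Equiv.addRight (a * r))
      fun u => F (u - a * r) * h₁ u * h₂ (u + (b - a) * r)]
    refine Finset.sum_congr rfl fun y _ => ?_
    simp only [Equiv.coe_addRight, add_sub_cancel_right]
    rw [show y + a * r + (b - a) * r = y + b * r by ring]
  rw [Finset.sum_comm, Finset.sum_congr rfl fun r _ => shift r, Finset.sum_comm]
  refine Finset.sum_congr rfl fun u _ => ?_
  rw [Finset.mul_sum, ← ZMod.sum_comp_affine hm
    (fun v => h₁ u * (h₂ v * F (b * (b - a)⁻¹ * u + -(a * (b - a)⁻¹) * v))) hba u]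
  refine Finset.sum_congr rfl fun r _ => ?_
  have arg : b * (b - a)⁻¹ * u + -(a * (b - a)⁻¹) * ((b - a) * r + u) = u - a * r := by
    field_simp
    ring
  rw [arg, add_comm ((b - a) * r) u]
  ring

/-- For a prime `m`, `F, h₁, h₂ : ZMod m → ℝ` with `h₁, h₂` bounded by `1`, and
distinct nonzero `a, b ∈ ZMod m`,
`(∑_{y,r} F(y)·h₁(y+a·r)·h₂(y+b·r))⁴ ≤ m⁵·E(F)`. -/
theorem bilinear_form_pow_four_le (m : ℕ) [NeZero m] (hm : Nat.Prime m)
    (F h₁ h₂ : ZMod m → ℝ) (hb₁ : ∀ x, |h₁ x| ≤ 1) (hb₂ : ∀ x, |h₂ x| ≤ 1)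
    (a b : ZMod m) (ha : a ≠ 0) (hb : b ≠ 0) (hab : a ≠ b) :
    (∑ y : ZMod m, ∑ r : ZMod m, F y * h₁ (y + a * r) * h₂ (y + b * r)) ^ 4
      ≤ (m : ℝ) ^ 5 * energy F := by
  have := Fact.mk hm
  have hba : (b - a)⁻¹ ≠ 0 := inv_ne_zero (sub_ne_zero.2 hab.symm)
  have box := bilinear_pow_four_le_box
    (fun u v => F (b * (b - a)⁻¹ * u + -(a * (b - a)⁻¹) * v)) h₁ h₂ hb₁ hb₂
  rw [sum_box_affine_eq_energy hm F (mul_ne_zero hb hba) (neg_ne_zero.2 (mul_ne_zero ha hba)),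
    ZMod.card] at box
  rw [sum_bilinear_eq_sum_affine hm F h₁ h₂ hab]
  exact box.trans_eq (by ring)
end
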